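/- Let X carry the topology τ_D generated by a directed multimetric D, let u₀ ∈ K_F(X), and let U ⊆ X×[0,1] be open in the product topology with hypo(u₀) ∩ U ≠ ∅. Then there exist d ∈ D and ε > 0 such that every u ∈ K_F(X) with d_{HF}(u,u₀) < ε satisfies hypo(u) ∩ U ≠ ∅. -/

import Mathlib

open Filter Topology Set

/-- A pseudometric on `X`. -/
def IsPseudometricFn {X : Type*} (d : X → X → ℝ) : Prop :=
  (∀ x y, 0 ≤ d x y) ∧ (∀ x, d x x = 0) ∧ (∀ x y, d x y = d y x) ∧
    ∀ x y z, d x y ≤ d x z + d z y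

/-- The open ball of a pseudometric. -/
def pball {X : Type*} (d : X → X → ℝ) (x : X) (ε : ℝ) : Set X := {y | d x y < ε}

/-- A multimetric: a family of pseudometrics separating points. -/
def IsMultimetric {X : Type*} (D : Set (X → X → ℝ)) : Prop :=
  (∀ d ∈ D, IsPseudometricFn d) ∧ ∀ x y : X, x ≠ y → ∃ d ∈ D, 0 < d x y

/-- A directed family of pseudometrics. -/
def IsDirectedMM {X : Type*} (D : Set (X → X → ℝ)) : Prop :=
  ∀ G : Finset (X → X → ℝ), ↑G ⊆ D → G.Nonempty →
    ∃ d ∈ D, ∀ g ∈ G, ∀ x y : X, g x y ≤ d x y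

/-- `U` is open in the topology `τ_D` generated by a family of pseudometrics `D`. -/
def IsTauOpen {X : Type*} (D : Set (X → X → ℝ)) (U : Set X) : Prop :=
  ∀ x ∈ U, ∃ ε > (0 : ℝ), ∃ G : Finset (X → X → ℝ), ↑G ⊆ D ∧ G.Nonempty ∧
    (⋂ d ∈ G, pball d x ε) ⊆ U

/-- `u` belongs to `K_F(X)`. -/
def IsFuzzyCompact {X : Type*} [TopologicalSpace X] (u : X → ℝ) : Prop :=
  (∀ x, u x ∈ Set.Icc (0 : ℝ) 1) ∧ (∃ x, u x = 1) ∧ UpperSemicontinuous u ∧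
    IsCompact (closure {x | 0 < u x})

open Classical in
/-- The `α`-cut of a fuzzy set. -/
noncomputable def acut {X : Type*} [TopologicalSpace X] (u : X → ℝ) (α : ℝ) : Set X :=
  if α = 0 then closure {x | 0 < u x} else {x | α ≤ u x}

/-- The Hausdorff pseudodistance associated to a pseudometric `d`. -/
noncomputable def hausPD {X : Type*} (d : X → X → ℝ) (K L : Set X) : ℝ :=
  max (sSup ((fun x => sInf ((fun y => d x y) '' L)) '' K))
      (sSup ((fun y => sInf ((fun x => d x y) '' K)) '' L))

/-- The fuzzy Hausdorff pseudodistance. -/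
noncomputable def dHF {X : Type*} [TopologicalSpace X] (d : X → X → ℝ) (u v : X → ℝ) : ℝ :=
  sSup ((fun α => hausPD d (acut u α) (acut v α)) '' Set.Icc (0 : ℝ) 1)

/-- The hypograph of a fuzzy set `u ∈ K_F(X)`, as a subset of `X × ℝ`:
`{(x,α) : x ∈ [u]^0, 0 ≤ α ≤ u(x)}`. -/
def hypo {X : Type*} [TopologicalSpace X] (u : X → ℝ) : Set (X × ℝ) :=
  {p | p.1 ∈ closure {x | 0 < u x} ∧ 0 ≤ p.2 ∧ p.2 ≤ u p.1}

theorem pball_isOpen_aux {X : Type*} [TopologicalSpace X]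
    (D : Set (X → X → ℝ)) (hD : IsMultimetric D)
    (htop : ∀ U : Set X, IsOpen U ↔ IsTauOpen D U) (d : X → X → ℝ) (hd : d ∈ D)
    (x : X) (r : ℝ) : IsOpen (pball d x r) := by
  rw [htop]
  intro y hy
  have hy' : d x y < r := hy
  refine ⟨r - d x y, by linarith, {d}, by simpa using hd, by simp, ?_⟩
  intro z hz
  have hz' : d y z < r - d x y := by simpa [pball] using hz
  have := (hD.1 d hd).2.2.2 x z y
  change d x z < r
  linarith

theorem compact_bound_aux {X : Type*} [TopologicalSpace X]
    (D : Set (X → X → ℝ)) (hD : IsMultimetric D)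
    (htop : ∀ U : Set X, IsOpen U ↔ IsTauOpen D U) (d : X → X → ℝ) (hd : d ∈ D)
    (x : X) (K : Set X) (hK : IsCompact K) : ∃ M : ℝ, 0 ≤ M ∧ ∀ y ∈ K, d x y ≤ M := by
  obtain ⟨n, hn⟩ := hK.elim_directed_cover (fun n : ℕ => pball d x n)
    (fun n => pball_isOpen_aux D hD htop d hd x n)
    (fun y _ => by
      obtain ⟨n, hn⟩ := exists_nat_gt (d x y)
      exact mem_iUnion.2 ⟨n, hn⟩)
    (Monotone.directed_le (fun a b hab y hy => by
      have h1 : d x y < a := hy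
      have h2 : (a : ℝ) ≤ b := by exact_mod_cast hab
      exact lt_of_lt_of_le h1 h2))
  exact ⟨n, n.cast_nonneg, fun y hy => le_of_lt (hn hy)⟩

theorem sInf_bound_aux {X : Type*} (f : X → ℝ) (L : Set X) (M : ℝ) (hM : 0 ≤ M)
    (h0 : ∀ y, 0 ≤ f y) (hL : ∀ y ∈ L, f y ≤ M) : sInf (f '' L) ≤ M := by
  rcases L.eq_empty_or_nonempty with rfl | ⟨y, hy⟩
  · simpa using hM
  · refine (csInf_le ⟨0, ?_⟩ (mem_image_of_mem f hy)).trans (hL y hy)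
    rintro _ ⟨z, _, rfl⟩
    exact h0 z

theorem acut_subset_aux {X : Type*} [TopologicalSpace X] (u : X → ℝ) (α : ℝ) (h : 0 ≤ α) :
    acut u α ⊆ closure {x | 0 < u x} := by
  unfold acut
  split_ifs with h0
  · exact subset_rfl
  · intro x hx
    exact subset_closure (lt_of_lt_of_le (lt_of_le_of_ne h (Ne.symm h0)) hx)

/-- If `U` is open (in the product topology) and meets the hypograph of `u₀ ∈ K_F(X)`,
then some `d_{HF}`-ball around `u₀` consists of fuzzy sets whose hypographs meet `U`. -/
theorem hypo_hit_open_of_dHF_close {X : Type*} [TopologicalSpace X]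
    (D : Set (X → X → ℝ)) (hD : IsMultimetric D) (hDd : IsDirectedMM D)
    (htop : ∀ U : Set X, IsOpen U ↔ IsTauOpen D U)
    (u₀ : X → ℝ) (hu₀ : IsFuzzyCompact u₀)
    (U : Set (X × ℝ)) (hU : IsOpen U) (hhit : (hypo u₀ ∩ U).Nonempty) :
    ∃ d ∈ D, ∃ ε > (0 : ℝ), ∀ u : X → ℝ, IsFuzzyCompact u → dHF d u u₀ < ε →
      (hypo u ∩ U).Nonempty := by
  obtain ⟨⟨x, α⟩, ⟨hx, hα0, hαu⟩, hxU⟩ := hhit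
  simp only at hx hα0 hαu
  have hα1 : α ≤ 1 := hαu.trans (hu₀.1 x).2
  obtain ⟨V, W, hV, hW, hxV, hαW, hVW⟩ := isOpen_prod_iff.1 hU x α hxU
  obtain ⟨ε, hε, G, hGD, hG, hGV⟩ := (htop V).1 hV x hxV
  obtain ⟨d, hd, hdG⟩ := hDd G hGD hG
  obtain ⟨hd0, -, hdsymm, hdtri⟩ := hD.1 d hd
  refine ⟨d, hd, ε, hε, fun u hu hlt => ?_⟩
  obtain ⟨M, hM0, hM⟩ := compact_bound_aux D hD htop d hd x _ (hu.2.2.2.union hu₀.2.2.2)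
  have hb : ∀ β, 0 ≤ β → ∀ y ∈ acut u β, ∀ z ∈ acut u₀ β, d y z ≤ 2 * M := by
    intro β hβ y hy z hz
    have h1 := hM y (Or.inl (acut_subset_aux u β hβ hy))
    have h2 := hM z (Or.inr (acut_subset_aux u₀ β hβ hz))
    have h3 := hdtri y z x
    rw [hdsymm y x] at h3
    linarith
  have hb1 : ∀ β, 0 ≤ β → ∀ y ∈ acut u β, sInf ((fun z => d y z) '' acut u₀ β) ≤ 2 * M :=
    fun β hβ y hy => sInf_bound_aux _ _ _ (by linarith) (fun z => hd0 y z)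
      (fun z hz => hb β hβ y hy z hz)
  have hb2 : ∀ β, 0 ≤ β → ∀ z ∈ acut u₀ β, sInf ((fun y => d y z) '' acut u β) ≤ 2 * M :=
    fun β hβ z hz => sInf_bound_aux _ _ _ (by linarith) (fun y => hd0 y z)
      (fun y hy => hb β hβ y hy z hz)
  have hxc : x ∈ acut u₀ α := by
    unfold acut
    split_ifs
    · exact hx
    · exact hαu
  have h1 : hausPD d (acut u α) (acut u₀ α) ≤ dHF d u u₀ := by
    refine le_csSup ⟨2 * M, ?_⟩ ⟨α, ⟨hα0, hα1⟩, rfl⟩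
    rintro _ ⟨β, hβ, rfl⟩
    refine max_le (Real.sSup_le ?_ (by linarith)) (Real.sSup_le ?_ (by linarith))
    · rintro _ ⟨y, hy, rfl⟩
      exact hb1 β hβ.1 y hy
    · rintro _ ⟨y, hy, rfl⟩
      exact hb2 β hβ.1 y hy
  have h2 : sInf ((fun y => d y x) '' acut u α) ≤ hausPD d (acut u α) (acut u₀ α) := by
    refine le_trans (b := sSup ((fun z => sInf ((fun y => d y z) '' acut u α)) '' acut u₀ α))
      (le_csSup ⟨2 * M, ?_⟩ ⟨x, hxc, rfl⟩) (le_max_right _ _)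
    rintro _ ⟨y, hy, rfl⟩
    exact hb2 α hα0 y hy
  have hne : (acut u α).Nonempty := by
    obtain ⟨y, hy⟩ := hu.2.1
    refine ⟨y, ?_⟩
    unfold acut
    split_ifs
    · exact subset_closure (by simp [hy])
    · simpa [hy] using hα1
  obtain ⟨_, ⟨y, hy, rfl⟩, hyx⟩ := exists_lt_of_csInf_lt (hne.image _) ((h2.trans h1).trans_lt hlt)
  have hyx' : d x y < ε := by rw [hdsymm]; exact hyx
  have hyV : y ∈ V := hGV (mem_iInter₂.2 fun g hg => lt_of_le_of_lt (hdG g hg x y) hyx')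
  refine ⟨(y, α), ⟨acut_subset_aux u α hα0 hy, hα0, ?_⟩, hVW ⟨hyV, hαW⟩⟩
  change α ≤ u y
  unfold acut at hy
  split_ifs at hy with h0
  · rw [h0]; exact (hu.1 y).1
  · exact hy
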